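/- Let (b,Q,ν) be a Lévy triplet on ℝ^d with associated Lévy generator A, and let β > 0 be such that ∫_{|y| ≥ 1} |y|^β ν(dy) < ∞. Then ∫_{ℝ^d} (1 + |x|^β) |Aφ(x)| dx < ∞ for every φ ∈ C_c^∞(ℝ^d). More precisely, for every R > 0 there exists a constant C > 0 (depending only on d, β and R) such that every φ ∈ C_c^∞(ℝ^d) with supp φ ⊆ B(0,R) satisfies ∫_{ℝ^d} (1 + |x|^β) |Aφ(x)| dx ≤ C ‖φ‖_{C_b²(ℝ^d)} ( |b| + |Q| + ∫_{|y| ≤ 1} |y|² ν(dy) + ∫_{|y| > 1} |y|^β ν(dy) ), where ‖φ‖_{C_b²(ℝ^d)} denotes the sum of the supremum norms of φ and of its derivatives up to order 2. -/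

import Mathlib

open MeasureTheory Real Filter Metric
open scoped ENNReal RealInnerProductSpace Topology

noncomputable section

/-- `ℝ^d` as a Euclidean space. -/
abbrev Ed (d : ℕ) := EuclideanSpace ℝ (Fin d)

/-- Indicator function `1_{(0,1)}(‖y‖)`. -/
def smallCut {d : ℕ} (y : Ed d) : ℝ := if 0 < ‖y‖ ∧ ‖y‖ < 1 then 1 else 0

/-- The Lévy generator associated with the triplet `(b, Q, ν)`:
`Af(x) = b·∇f(x) + (1/2) tr(Q ∇²f(x)) + ∫ (f(x+y) - f(x) - y·∇f(x) 1_{(0,1)}(|y|)) ν(dy)`. -/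
noncomputable def levyGen {d : ℕ} (b : Ed d) (Q : Matrix (Fin d) (Fin d) ℝ)
    (ν : Measure (Ed d)) (f : Ed d → ℝ) (x : Ed d) : ℝ :=
  ⟪b, gradient f x⟫
    + (1 / 2) * ∑ i, ∑ j, Q i j *
        fderiv ℝ (fun z => fderiv ℝ f z (EuclideanSpace.single j 1)) x (EuclideanSpace.single i 1)
    + ∫ y, (f (x + y) - f x - smallCut y * ⟪y, gradient f x⟫) ∂ν

/-- The characteristic exponent associated with the triplet `(b, Q, ν)`:
`ψ(ξ) = i b·ξ + (1/2) ξ·Qξ + ∫ (1 - e^{iy·ξ} + iy·ξ 1_{(0,1)}(|y|)) ν(dy)`. -/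
noncomputable def charExp {d : ℕ} (b : Ed d) (Q : Matrix (Fin d) (Fin d) ℝ)
    (ν : Measure (Ed d)) (ξ : Ed d) : ℂ :=
  Complex.I * ((⟪b, ξ⟫ : ℝ) : ℂ)
    + (1 / 2) * ((∑ i, ∑ j, ξ i * Q i j * ξ j : ℝ) : ℂ)
    + ∫ y, (1 - Complex.exp (Complex.I * ((⟪y, ξ⟫ : ℝ) : ℂ))
        + Complex.I * ((⟪y, ξ⟫ : ℝ) : ℂ) * (smallCut y : ℂ)) ∂ν

/-- `(b, Q, ν)` is a Lévy triplet on `ℝ^d`: `Q` is symmetric positive semidefinite,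
`ν({0}) = 0` and `∫ min(1,|y|²) ν(dy) < ∞`. -/
structure IsLevyTriplet {d : ℕ} (b : Ed d) (Q : Matrix (Fin d) (Fin d) ℝ)
    (ν : Measure (Ed d)) : Prop where
  posSemidef : Q.PosSemidef
  nuZero : ν {0} = 0
  nuFin : ∫⁻ y, ENNReal.ofReal (min 1 (‖y‖ ^ 2)) ∂ν ≠ ⊤

/-- `p` is a probability density whose Fourier transform is `e^{-t ψ}`, where `ψ` is the
characteristic exponent of the Lévy triplet `(b, Q, ν)`. -/
def IsTransDensity {d : ℕ} (b : Ed d) (Q : Matrix (Fin d) (Fin d) ℝ) (ν : Measure (Ed d))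
    (t : ℝ) (p : Ed d → ℝ) : Prop :=
  (∀ x, 0 ≤ p x) ∧ (∫ x, p x) = 1 ∧
    ∀ ξ : Ed d, (∫ x, Complex.exp (Complex.I * ((⟪ξ, x⟫ : ℝ) : ℂ)) * (p x : ℂ))
      = Complex.exp (-(t : ℂ) * charExp b Q ν ξ)

/-- `u` is a weak solution of `A u = 0` on `ℝ^d`, tested against the adjoint generator `A*`,
i.e. the Lévy generator with triplet `(-b, Q, ν ∘ (y ↦ -y))`. -/
def IsWeakSolZero {d : ℕ} (b : Ed d) (Q : Matrix (Fin d) (Fin d) ℝ) (ν : Measure (Ed d))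
    (u : Ed d → ℝ) : Prop :=
  ∀ φ : Ed d → ℝ, ContDiff ℝ (⊤ : ℕ∞) φ → HasCompactSupport φ →
    ∫ x, u x * levyGen (-b) Q (Measure.map Neg.neg ν) φ x = 0

/-- The `C_b²`-norm of `φ`: the sum of the supremum norms of `φ` and of its derivatives of
order `1` and `2`. -/
noncomputable def cbNorm2 {d : ℕ} (φ : Ed d → ℝ) : ℝ :=
  ∑ i ∈ Finset.range 3, ⨆ x : Ed d, ‖iteratedFDeriv ℝ i φ x‖

lemma ContDiff.norm_iteratedFDeriv_le_iSup {d : ℕ} {φ : Ed d → ℝ}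
    (hφ : ContDiff ℝ (⊤ : ℕ∞) φ) (hc : HasCompactSupport φ) (i : ℕ) (x : Ed d) :
    ‖iteratedFDeriv ℝ i φ x‖ ≤ ⨆ z : Ed d, ‖iteratedFDeriv ℝ i φ z‖ := by
  have hcont : Continuous (iteratedFDeriv ℝ i φ) :=
    hφ.continuous_iteratedFDeriv (by exact_mod_cast le_top)
  obtain ⟨C, hC⟩ := hcont.bounded_above_of_compact_support (hc.iteratedFDeriv i)
  exact le_ciSup (f := fun z => ‖iteratedFDeriv ℝ i φ z‖) ⟨C, by rintro _ ⟨z, rfl⟩; exact hC z⟩ x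

lemma norm_iteratedFDeriv_le_cbNorm2 {d : ℕ} {φ : Ed d → ℝ}
    (hφ : ContDiff ℝ (⊤ : ℕ∞) φ) (hc : HasCompactSupport φ) {i : ℕ} (hi : i < 3) (x : Ed d) :
    ‖iteratedFDeriv ℝ i φ x‖ ≤ cbNorm2 φ :=
  (hφ.norm_iteratedFDeriv_le_iSup hc i x).trans <|
    Finset.single_le_sum (f := fun i => ⨆ x : Ed d, ‖iteratedFDeriv ℝ i φ x‖)
      (fun _ _ => Real.iSup_nonneg fun _ => norm_nonneg _) (Finset.mem_range.2 hi)

lemma abs_le_cbNorm2 {d : ℕ} {φ : Ed d → ℝ}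
    (hφ : ContDiff ℝ (⊤ : ℕ∞) φ) (hc : HasCompactSupport φ) (x : Ed d) :
    |φ x| ≤ cbNorm2 φ := by
  simpa [norm_iteratedFDeriv_zero] using
    norm_iteratedFDeriv_le_cbNorm2 hφ hc (show 0 < 3 by norm_num) x

lemma norm_fderiv_le_cbNorm2 {d : ℕ} {φ : Ed d → ℝ}
    (hφ : ContDiff ℝ (⊤ : ℕ∞) φ) (hc : HasCompactSupport φ) (x : Ed d) :
    ‖fderiv ℝ φ x‖ ≤ cbNorm2 φ := by
  have h := norm_iteratedFDeriv_le_cbNorm2 hφ hc (show 0 + 1 < 3 by norm_num) x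
  rwa [← norm_iteratedFDeriv_fderiv, norm_iteratedFDeriv_zero] at h

lemma norm_fderiv_fderiv_le_cbNorm2 {d : ℕ} {φ : Ed d → ℝ}
    (hφ : ContDiff ℝ (⊤ : ℕ∞) φ) (hc : HasCompactSupport φ) (x : Ed d) :
    ‖fderiv ℝ (fderiv ℝ φ) x‖ ≤ cbNorm2 φ := by
  have h := norm_iteratedFDeriv_le_cbNorm2 hφ hc (show 0 + 1 + 1 < 3 by norm_num) x
  rwa [← norm_iteratedFDeriv_fderiv, ← norm_iteratedFDeriv_fderiv, norm_iteratedFDeriv_zero] at h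

lemma contDiff_fderiv_of_smooth {d : ℕ} {φ : Ed d → ℝ} (hφ : ContDiff ℝ (⊤ : ℕ∞) φ) :
    ContDiff ℝ (⊤ : ℕ∞) (fderiv ℝ φ) :=
  hφ.fderiv_right (by norm_cast)

/-- Second-order Taylor estimate with the `C_b²`-norm. -/
lemma abs_taylor_le_cbNorm2 {d : ℕ} {φ : Ed d → ℝ}
    (hφ : ContDiff ℝ (⊤ : ℕ∞) φ) (hc : HasCompactSupport φ) (x y : Ed d) :
    |φ (x + y) - φ x - fderiv ℝ φ x y| ≤ cbNorm2 φ * ‖y‖ ^ 2 := by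
  have hφ' := contDiff_fderiv_of_smooth hφ
  have hM : 0 ≤ cbNorm2 φ := (abs_nonneg _).trans (abs_le_cbNorm2 hφ hc 0)
  have hlip : ∀ z ∈ closedBall x ‖y‖, ‖fderiv ℝ φ z - fderiv ℝ φ x‖ ≤ cbNorm2 φ * ‖y‖ := by
    intro z hz
    have h := convex_univ.norm_image_sub_le_of_norm_fderiv_le (𝕜 := ℝ) (f := fderiv ℝ φ)
      (fun z _ => (hφ'.differentiable (by simp)) z)
      (fun z _ => norm_fderiv_fderiv_le_cbNorm2 hφ hc z) (Set.mem_univ x) (Set.mem_univ z)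
    refine h.trans (mul_le_mul_of_nonneg_left ?_ hM)
    rwa [mem_closedBall, dist_eq_norm] at hz
  have h := (convex_closedBall x ‖y‖).norm_image_sub_le_of_norm_fderiv_le' (𝕜 := ℝ) (f := φ)
    (fun z _ => (hφ.differentiable (by simp)) z) hlip
    (mem_closedBall_self (norm_nonneg y)) (show x + y ∈ closedBall x ‖y‖ by simp)
  simpa [sq, mul_assoc] using h

lemma IsLevyTriplet.sFinite {d : ℕ} {b : Ed d} {Q : Matrix (Fin d) (Fin d) ℝ}
    {ν : Measure (Ed d)} (h : IsLevyTriplet b Q ν) : SFinite ν := by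
  have hmeas : Measurable fun y : Ed d => ENNReal.ofReal (min 1 (‖y‖ ^ 2)) := by fun_prop
  have hne : ∀ᵐ y ∂ν, ENNReal.ofReal (min 1 (‖y‖ ^ 2)) ≠ 0 := by
    have h0 : ∀ᵐ y ∂ν, y ≠ 0 := by
      rw [ae_iff]
      simpa using h.nuZero
    filter_upwards [h0] with y hy
    have := norm_pos_iff.2 hy
    simp only [ne_eq, ENNReal.ofReal_eq_zero, not_le]
    positivity
  have hfin := isFiniteMeasure_withDensity h.nuFin
  rw [← withDensity_inv_same hmeas hne (ae_of_all _ fun _ => ENNReal.ofReal_ne_top)]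
  infer_instance

lemma IsLevyTriplet.integrableOn_norm_sq {d : ℕ} {b : Ed d} {Q : Matrix (Fin d) (Fin d) ℝ}
    {ν : Measure (Ed d)} (h : IsLevyTriplet b Q ν) :
    IntegrableOn (fun y : Ed d => ‖y‖ ^ 2) {y : Ed d | ‖y‖ ≤ 1} ν := by
  have hS : MeasurableSet {y : Ed d | ‖y‖ ≤ 1} := measurableSet_le measurable_norm measurable_const
  have hint : Integrable (fun y : Ed d => min 1 (‖y‖ ^ 2)) ν := by
    refine ⟨by fun_prop, ?_⟩
    rw [hasFiniteIntegral_iff_ofReal (ae_of_all _ fun y => by positivity)]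
    exact h.nuFin.lt_top
  refine hint.integrableOn.congr_fun (fun y hy => ?_) hS
  exact min_eq_right (pow_le_one₀ (norm_nonneg _) hy)

/-- The function `|y|²` on `{|y| ≤ 1}` and `|y|^β` on `{|y| > 1}`. -/
def levyWeight {d : ℕ} (β : ℝ) (y : Ed d) : ℝ :=
  {y : Ed d | ‖y‖ ≤ 1}.indicator (fun y => ‖y‖ ^ 2) y
    + {y : Ed d | 1 < ‖y‖}.indicator (fun y => ‖y‖ ^ β) y

lemma levyWeight_nonneg {d : ℕ} (β : ℝ) (y : Ed d) : 0 ≤ levyWeight β y :=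
  add_nonneg (Set.indicator_nonneg (fun _ _ => by positivity) _)
    (Set.indicator_nonneg (fun _ _ => by positivity) _)

lemma levyWeight_of_le {d : ℕ} (β : ℝ) {y : Ed d} (hy : ‖y‖ ≤ 1) :
    levyWeight β y = ‖y‖ ^ 2 := by
  simp [levyWeight, Set.indicator, hy, not_lt.2 hy]

lemma levyWeight_of_lt {d : ℕ} (β : ℝ) {y : Ed d} (hy : 1 < ‖y‖) :
    levyWeight β y = ‖y‖ ^ β := by
  simp [levyWeight, Set.indicator, hy, not_le.2 hy]

lemma measurable_levyWeight {d : ℕ} (β : ℝ) : Measurable (levyWeight (d := d) β) :=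
  ((by fun_prop : Measurable fun y : Ed d => ‖y‖ ^ 2).indicator
      (measurableSet_le measurable_norm measurable_const)).add
    ((by fun_prop : Measurable fun y : Ed d => ‖y‖ ^ β).indicator
      (measurableSet_lt measurable_const measurable_norm))

lemma IsLevyTriplet.lintegral_levyWeight {d : ℕ} {b : Ed d} {Q : Matrix (Fin d) (Fin d) ℝ}
    {ν : Measure (Ed d)} (h : IsLevyTriplet b Q ν) {β : ℝ}
    (hν : IntegrableOn (fun y => ‖y‖ ^ β) {y : Ed d | 1 ≤ ‖y‖} ν) :
    ∫⁻ y, ENNReal.ofReal (levyWeight β y) ∂ν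
      = ENNReal.ofReal ((∫ y in {y : Ed d | ‖y‖ ≤ 1}, ‖y‖ ^ 2 ∂ν)
          + ∫ y in {y : Ed d | 1 < ‖y‖}, ‖y‖ ^ β ∂ν) := by
  have hS : MeasurableSet {y : Ed d | ‖y‖ ≤ 1} := measurableSet_le measurable_norm measurable_const
  have hT : MeasurableSet {y : Ed d | 1 < ‖y‖} := measurableSet_lt measurable_const measurable_norm
  have h1 := h.integrableOn_norm_sq.integrable_indicator hS
  have hν' : IntegrableOn (fun y => ‖y‖ ^ β) {y : Ed d | 1 < ‖y‖} ν :=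
    hν.mono_set (Set.ofPred_subset_ofPred.2 fun _ hy => le_of_lt hy)
  have h2 := hν'.integrable_indicator hT
  rw [← integral_indicator hS, ← integral_indicator hT, ← integral_add h1 h2]
  exact (ofReal_integral_eq_lintegral_ofReal (h1.add h2)
    (ae_of_all _ (levyWeight_nonneg β))).symm

/-- The integrand of the jump part of the generator. -/
def jumpIntegrand {d : ℕ} (φ : Ed d → ℝ) (x y : Ed d) : ℝ :=
  φ (x + y) - φ x - smallCut y * ⟪y, gradient φ x⟫

/-- The drift and diffusion part of the generator. -/
def localPart {d : ℕ} (b : Ed d) (Q : Matrix (Fin d) (Fin d) ℝ) (φ : Ed d → ℝ) (x : Ed d) : ℝ :=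
  ⟪b, gradient φ x⟫
    + (1 / 2) * ∑ i, ∑ j, Q i j *
        fderiv ℝ (fun z => fderiv ℝ φ z (EuclideanSpace.single j 1)) x (EuclideanSpace.single i 1)

lemma inner_gradient_eq_fderiv {d : ℕ} (φ : Ed d → ℝ) (x y : Ed d) :
    ⟪y, gradient φ x⟫ = fderiv ℝ φ x y := by
  rw [inner_gradient_right, conj_trivial]

lemma fderiv_eq_zero_of_notMem {d : ℕ} {φ : Ed d → ℝ} {x : Ed d} (hx : x ∉ tsupport φ) :
    fderiv ℝ φ x = 0 :=
  image_eq_zero_of_notMem_tsupport fun h => hx (tsupport_fderiv_subset ℝ h)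

lemma fderiv_fderiv_apply {d : ℕ} {φ : Ed d → ℝ} (hφ : ContDiff ℝ (⊤ : ℕ∞) φ) (x u v : Ed d) :
    fderiv ℝ (fun z => fderiv ℝ φ z u) x v = fderiv ℝ (fderiv ℝ φ) x v u := by
  have hd : DifferentiableAt ℝ (fderiv ℝ φ) x :=
    ((contDiff_fderiv_of_smooth hφ).differentiable (by simp)) x
  rw [fderiv_clm_apply hd (differentiableAt_const u)]
  simp

lemma abs_entry_le_sqrt_sum_sq {d : ℕ} (Q : Matrix (Fin d) (Fin d) ℝ) (i j : Fin d) :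
    |Q i j| ≤ √(∑ i, ∑ j, (Q i j) ^ 2) := by
  refine Real.abs_le_sqrt ?_
  calc (Q i j) ^ 2 ≤ ∑ j, (Q i j) ^ 2 :=
        Finset.single_le_sum (f := fun j => (Q i j) ^ 2) (fun _ _ => sq_nonneg _)
          (Finset.mem_univ j)
    _ ≤ ∑ i, ∑ j, (Q i j) ^ 2 :=
        Finset.single_le_sum (f := fun i => ∑ j, (Q i j) ^ 2)
          (fun _ _ => Finset.sum_nonneg fun _ _ => sq_nonneg _) (Finset.mem_univ i)

lemma abs_localPart_le {d : ℕ} (b : Ed d) (Q : Matrix (Fin d) (Fin d) ℝ) {φ : Ed d → ℝ}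
    (hφ : ContDiff ℝ (⊤ : ℕ∞) φ) (hc : HasCompactSupport φ) (x : Ed d) :
    |localPart b Q φ x| ≤
      cbNorm2 φ * (‖b‖ + (d : ℝ) ^ 2 * √(∑ i, ∑ j, (Q i j) ^ 2)) := by
  have hM : 0 ≤ cbNorm2 φ := (abs_nonneg _).trans (abs_le_cbNorm2 hφ hc 0)
  set q := √(∑ i, ∑ j, (Q i j) ^ 2)
  have hq0 : 0 ≤ q := Real.sqrt_nonneg _
  have h1 : |⟪b, gradient φ x⟫| ≤ cbNorm2 φ * ‖b‖ := by
    rw [inner_gradient_eq_fderiv]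
    exact (fderiv ℝ φ x).le_of_opNorm_le (norm_fderiv_le_cbNorm2 hφ hc x) b
  have h2 : |∑ i, ∑ j, Q i j * fderiv ℝ (fun z => fderiv ℝ φ z (EuclideanSpace.single j 1)) x
      (EuclideanSpace.single i 1)| ≤ ∑ _i : Fin d, ∑ _j : Fin d, q * cbNorm2 φ := by
    refine (Finset.abs_sum_le_sum_abs _ _).trans (Finset.sum_le_sum fun i _ => ?_)
    refine (Finset.abs_sum_le_sum_abs _ _).trans (Finset.sum_le_sum fun j _ => ?_)
    rw [abs_mul, fderiv_fderiv_apply hφ]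
    refine mul_le_mul (abs_entry_le_sqrt_sum_sq Q i j) ?_ (abs_nonneg _) hq0
    have := (fderiv ℝ (fderiv ℝ φ) x).le_of_opNorm₂_le_of_le
      (norm_fderiv_fderiv_le_cbNorm2 hφ hc x)
      (show ‖(EuclideanSpace.single i 1 : Ed d)‖ ≤ 1 by simp)
      (show ‖(EuclideanSpace.single j 1 : Ed d)‖ ≤ 1 by simp)
    simpa using this
  simp only [Finset.sum_const, Finset.card_univ, Fintype.card_fin, nsmul_eq_mul] at h2
  have h3 : 0 ≤ (d : ℝ) * (d * (q * cbNorm2 φ)) := by positivity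
  rw [localPart]
  refine (abs_add_le _ _).trans ?_
  rw [abs_mul, abs_of_pos (by norm_num : (0 : ℝ) < 1 / 2)]
  nlinarith

lemma localPart_eq_zero {d : ℕ} (b : Ed d) (Q : Matrix (Fin d) (Fin d) ℝ) {φ : Ed d → ℝ}
    (hφ : ContDiff ℝ (⊤ : ℕ∞) φ) {x : Ed d} (hx : x ∉ tsupport φ) : localPart b Q φ x = 0 := by
  have h : fderiv ℝ (fderiv ℝ φ) x = 0 :=
    image_eq_zero_of_notMem_tsupport fun h =>
      hx (tsupport_fderiv_subset ℝ (tsupport_fderiv_subset ℝ h))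
  simp [localPart, fderiv_eq_zero_of_notMem hx, fderiv_fderiv_apply hφ, h]

lemma one_add_norm_rpow_le {d : ℕ} {β r : ℝ} (hβ : 0 < β) {x : Ed d} (hx : ‖x‖ ≤ r) :
    1 + ‖x‖ ^ β ≤ 1 + r ^ β := by
  have := Real.rpow_le_rpow (norm_nonneg x) hx hβ.le
  linarith

lemma weighted_abs_localPart_le {d : ℕ} {β R : ℝ} (hβ : 0 < β)
    (b : Ed d) (Q : Matrix (Fin d) (Fin d) ℝ) {φ : Ed d → ℝ}
    (hφ : ContDiff ℝ (⊤ : ℕ∞) φ) (hc : HasCompactSupport φ)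
    (hs : tsupport φ ⊆ ball (0 : Ed d) R) (x : Ed d) :
    (1 + ‖x‖ ^ β) * |localPart b Q φ x| ≤
      (1 + R ^ β) * (cbNorm2 φ * (‖b‖ + (d : ℝ) ^ 2 * √(∑ i, ∑ j, (Q i j) ^ 2)))
        * (ball (0 : Ed d) R).indicator 1 x := by
  by_cases hx : x ∈ ball (0 : Ed d) R
  · have hx' := mem_ball_zero_iff.1 hx
    have hw := one_add_norm_rpow_le hβ hx'.le
    rw [Set.indicator_of_mem hx, Pi.one_apply, mul_one]
    exact mul_le_mul hw (abs_localPart_le b Q hφ hc x) (abs_nonneg _)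
      (le_trans (by positivity) hw)
  · simp [Set.indicator_of_notMem hx, localPart_eq_zero b Q hφ fun h => hx (hs h)]

lemma weighted_abs_jumpIntegrand_le {d : ℕ} {β R : ℝ} (hβ : 0 < β) (hR : 0 < R)
    {φ : Ed d → ℝ} (hφ : ContDiff ℝ (⊤ : ℕ∞) φ) (hc : HasCompactSupport φ)
    (hs : tsupport φ ⊆ ball (0 : Ed d) R) (x y : Ed d) :
    (1 + ‖x‖ ^ β) * |jumpIntegrand φ x y| ≤
      2 * cbNorm2 φ * (1 + (R + 1) ^ β) * levyWeight β y
        * ((ball (0 : Ed d) (R + 1)).indicator 1 x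
          + (ball (0 : Ed d) (R + 1)).indicator 1 (x + y)) := by
  have hM : 0 ≤ cbNorm2 φ := (abs_nonneg _).trans (abs_le_cbNorm2 hφ hc 0)
  have hφ0 : ∀ z : Ed d, R ≤ ‖z‖ → φ z = 0 := fun z hz =>
    image_eq_zero_of_notMem_tsupport fun h => (mem_ball_zero_iff.1 (hs h)).not_ge hz
  have hind : ∀ z : Ed d, 0 ≤ (ball (0 : Ed d) (R + 1)).indicator (1 : Ed d → ℝ) z := fun z =>
    Set.indicator_nonneg (fun _ _ => zero_le_one) z
  have hind1 : ∀ z : Ed d, ‖z‖ < R + 1 →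
      (ball (0 : Ed d) (R + 1)).indicator (1 : Ed d → ℝ) z = 1 := fun z hz =>
    Set.indicator_of_mem (mem_ball_zero_iff.2 hz) _
  have hrp : 0 < (R + 1) ^ β := by positivity
  have hφabs : ∀ z, |φ z| ≤
      cbNorm2 φ * (ball (0 : Ed d) (R + 1)).indicator (1 : Ed d → ℝ) z := fun z => by
    rcases lt_or_ge ‖z‖ R with hz | hz
    · rw [hind1 z (by linarith), mul_one]
      exact abs_le_cbNorm2 hφ hc z
    · rw [hφ0 z hz, abs_zero]
      exact mul_nonneg hM (hind z)
  have htri : ‖x‖ ≤ ‖x + y‖ + ‖y‖ := by simpa using norm_sub_le (x + y) y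
  rcases le_or_gt ‖y‖ 1 with hy | hy
  · rw [levyWeight_of_le β hy]
    rcases lt_or_ge ‖x‖ (R + 1) with hx | hx
    · have hJ : |jumpIntegrand φ x y| ≤ 2 * cbNorm2 φ * ‖y‖ ^ 2 := by
        rw [jumpIntegrand, inner_gradient_eq_fderiv, smallCut]
        split_ifs with hcut
        · have := abs_taylor_le_cbNorm2 hφ hc x y
          rw [one_mul]
          nlinarith [mul_nonneg hM (sq_nonneg ‖y‖)]
        · rcases eq_or_ne y 0 with rfl | hy0
          · simp
          · have h1 : ‖y‖ = 1 :=
              le_antisymm hy (not_lt.1 fun h => hcut ⟨norm_pos_iff.2 hy0, h⟩)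
            rw [h1, zero_mul, sub_zero]
            have := abs_sub (φ (x + y)) (φ x)
            linarith [abs_le_cbNorm2 hφ hc x, abs_le_cbNorm2 hφ hc (x + y)]
      have hw := one_add_norm_rpow_le hβ hx.le
      rw [hind1 x hx]
      calc (1 + ‖x‖ ^ β) * |jumpIntegrand φ x y|
          ≤ (1 + (R + 1) ^ β) * (2 * cbNorm2 φ * ‖y‖ ^ 2) :=
            mul_le_mul hw hJ (abs_nonneg _) (by positivity)
        _ = 2 * cbNorm2 φ * (1 + (R + 1) ^ β) * ‖y‖ ^ 2 * 1 := by ring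
        _ ≤ _ := mul_le_mul_of_nonneg_left (le_add_of_nonneg_right (hind _)) (by positivity)
    · have h0 : jumpIntegrand φ x y = 0 := by
        have hx' : x ∉ tsupport φ := fun h => by
          have := mem_ball_zero_iff.1 (hs h)
          linarith
        rw [jumpIntegrand, inner_gradient_eq_fderiv, fderiv_eq_zero_of_notMem hx',
          hφ0 x (by linarith), hφ0 (x + y) (by linarith)]
        simp
      rw [h0, abs_zero, mul_zero]
      have := hind x
      have := hind (x + y)
      positivity
  · rw [levyWeight_of_lt β hy]
    have hcut : smallCut y = 0 := if_neg fun h => h.2.not_gt hy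
    have hyβ : 1 ≤ ‖y‖ ^ β := Real.one_le_rpow hy.le hβ.le
    have hJ : |jumpIntegrand φ x y| ≤ cbNorm2 φ *
        ((ball (0 : Ed d) (R + 1)).indicator 1 x
          + (ball (0 : Ed d) (R + 1)).indicator 1 (x + y)) := by
      rw [jumpIntegrand, hcut, zero_mul, sub_zero]
      linarith [abs_sub (φ (x + y)) (φ x), hφabs x, hφabs (x + y)]
    rcases le_or_gt ‖x‖ ((R + 1) * ‖y‖) with hx | hx
    · have hw : 1 + ‖x‖ ^ β ≤ (1 + (R + 1) ^ β) * ‖y‖ ^ β := by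
        have := Real.rpow_le_rpow (norm_nonneg x) hx hβ.le
        rw [Real.mul_rpow (by positivity) (norm_nonneg y)] at this
        linarith
      have hI := add_nonneg (hind x) (hind (x + y))
      calc (1 + ‖x‖ ^ β) * |jumpIntegrand φ x y|
          ≤ ((1 + (R + 1) ^ β) * ‖y‖ ^ β) * (cbNorm2 φ *
            ((ball (0 : Ed d) (R + 1)).indicator 1 x
              + (ball (0 : Ed d) (R + 1)).indicator 1 (x + y))) :=
            mul_le_mul hw hJ (abs_nonneg _) (by positivity)
        _ = cbNorm2 φ * (1 + (R + 1) ^ β) * ‖y‖ ^ β *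
            ((ball (0 : Ed d) (R + 1)).indicator 1 x
              + (ball (0 : Ed d) (R + 1)).indicator 1 (x + y)) := by ring
        _ ≤ _ := by
          gcongr
          linarith
    · have h0 : jumpIntegrand φ x y = 0 := by
        rw [jumpIntegrand, hcut, hφ0 x (by nlinarith), hφ0 (x + y) (by nlinarith)]
        simp
      rw [h0, abs_zero, mul_zero]
      have := hind x
      have := hind (x + y)
      positivity

lemma measurable_smallCut {d : ℕ} : Measurable (smallCut (d := d)) :=
  Measurable.ite ((measurableSet_lt measurable_const measurable_norm).inter
    (measurableSet_lt measurable_norm measurable_const)) measurable_const measurable_const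

lemma measurable_uncurry_jumpIntegrand {d : ℕ} {φ : Ed d → ℝ} (hφ : ContDiff ℝ (⊤ : ℕ∞) φ) :
    Measurable (Function.uncurry (jumpIntegrand φ)) := by
  have h0 := hφ.continuous
  have h1 : Continuous fun p : Ed d × Ed d => fderiv ℝ φ p.1 p.2 :=
    ((contDiff_fderiv_of_smooth hφ).continuous.comp continuous_fst).clm_apply continuous_snd
  have h2 : Continuous fun p : Ed d × Ed d => φ (p.1 + p.2) - φ p.1 := by fun_prop
  have h3 : Function.uncurry (jumpIntegrand φ) = fun p : Ed d × Ed d =>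
      φ (p.1 + p.2) - φ p.1 - smallCut p.2 * fderiv ℝ φ p.1 p.2 := by
    funext p
    simp [Function.uncurry, jumpIntegrand]
  rw [h3]
  exact h2.measurable.sub ((measurable_smallCut.comp measurable_snd).mul h1.measurable)

lemma measurable_levyGen {d : ℕ} {b : Ed d} {Q : Matrix (Fin d) (Fin d) ℝ}
    {ν : Measure (Ed d)} (h : IsLevyTriplet b Q ν) {φ : Ed d → ℝ}
    (hφ : ContDiff ℝ (⊤ : ℕ∞) φ) : Measurable (levyGen b Q ν φ) := by
  have := h.sFinite
  have hφ' := contDiff_fderiv_of_smooth hφ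
  have hJ : Measurable fun x => ∫ y, jumpIntegrand φ x y ∂ν :=
    (measurable_uncurry_jumpIntegrand hφ).stronglyMeasurable.integral_prod_right.measurable
  have hc1 := hφ'.continuous
  have hc2 := hφ'.continuous_fderiv (by simp)
  have hL : Continuous (localPart b Q φ) := by
    unfold localPart
    simp only [inner_gradient_eq_fderiv, fderiv_fderiv_apply hφ]
    fun_prop
  exact hL.measurable.add hJ

/-- The weighted `L¹` estimate for `Aφ`, as a bound on a lower Lebesgue integral. -/
lemma lintegral_weighted_levyGen_le {d : ℕ} {β R : ℝ} (hβ : 0 < β) (hR : 0 < R)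
    {b : Ed d} {Q : Matrix (Fin d) (Fin d) ℝ} {ν : Measure (Ed d)} (h : IsLevyTriplet b Q ν)
    (hν : IntegrableOn (fun y => ‖y‖ ^ β) {y : Ed d | 1 ≤ ‖y‖} ν)
    {φ : Ed d → ℝ} (hφ : ContDiff ℝ (⊤ : ℕ∞) φ) (hc : HasCompactSupport φ)
    (hs : tsupport φ ⊆ ball (0 : Ed d) R) :
    ∫⁻ x, ENNReal.ofReal ((1 + ‖x‖ ^ β) * |levyGen b Q ν φ x|) ≤
      ENNReal.ofReal (((1 + (R + 1) ^ β) * (volume.real (ball (0 : Ed d) (R + 1)) + 1)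
          * ((d : ℝ) ^ 2 + 4)) * cbNorm2 φ *
        (‖b‖ + √(∑ i, ∑ j, (Q i j) ^ 2)
          + (∫ y in {y : Ed d | ‖y‖ ≤ 1}, ‖y‖ ^ 2 ∂ν)
          + ∫ y in {y : Ed d | 1 < ‖y‖}, ‖y‖ ^ β ∂ν)) := by
  have := h.sFinite
  have hM : 0 ≤ cbNorm2 φ := (abs_nonneg _).trans (abs_le_cbNorm2 hφ hc 0)
  have hq0 : 0 ≤ √(∑ i, ∑ j, (Q i j) ^ 2) := Real.sqrt_nonneg _
  have hI1 : 0 ≤ ∫ y in {y : Ed d | ‖y‖ ≤ 1}, ‖y‖ ^ 2 ∂ν :=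
    integral_nonneg fun _ => by positivity
  have hI2 : 0 ≤ ∫ y in {y : Ed d | 1 < ‖y‖}, ‖y‖ ^ β ∂ν :=
    integral_nonneg fun _ => by positivity
  have hweight := h.lintegral_levyWeight hν
  set q := √(∑ i, ∑ j, (Q i j) ^ 2)
  set I₁ := ∫ y in {y : Ed d | ‖y‖ ≤ 1}, ‖y‖ ^ 2 ∂ν
  set I₂ := ∫ y in {y : Ed d | 1 < ‖y‖}, ‖y‖ ^ β ∂ν
  set B := ball (0 : Ed d) (R + 1)
  set V := volume.real B
  set W := 1 + (R + 1) ^ β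
  have hV0 : 0 ≤ V := measureReal_nonneg
  have hW0 : 0 ≤ W := by positivity
  have hVB : volume B = ENNReal.ofReal V := (ofReal_measureReal measure_ball_lt_top.ne).symm
  set a := W * (cbNorm2 φ * (‖b‖ + (d : ℝ) ^ 2 * q)) with ha
  have ha0 : 0 ≤ a := by positivity
  set c := 2 * cbNorm2 φ * W with hcdef
  have hc0 : 0 ≤ c := by positivity
  let χ : Ed d → ℝ≥0∞ := B.indicator 1
  have hχm : Measurable χ := measurable_one.indicator measurableSet_ball
  have hχ : ∀ z, ENNReal.ofReal (B.indicator 1 z) = χ z := fun z => by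
    by_cases hz : z ∈ B <;> simp [χ, hz]
  have hχint : ∫⁻ x, χ x = ENNReal.ofReal V := by
    rw [lintegral_indicator_one measurableSet_ball, hVB]
  have hind : ∀ z : Ed d, 0 ≤ B.indicator (1 : Ed d → ℝ) z := fun z =>
    Set.indicator_nonneg (fun _ _ => zero_le_one) z
  have hpt : ∀ x, ENNReal.ofReal ((1 + ‖x‖ ^ β) * |levyGen b Q ν φ x|) ≤
      ENNReal.ofReal a * χ x +
        ∫⁻ y, ENNReal.ofReal (c * levyWeight β y) * (χ x + χ (x + y)) ∂ν := by
    intro x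
    have hw : 0 ≤ 1 + ‖x‖ ^ β := by positivity
    have hgen : levyGen b Q ν φ x = localPart b Q φ x + ∫ y, jumpIntegrand φ x y ∂ν := rfl
    have hlocal : (1 + ‖x‖ ^ β) * |localPart b Q φ x| ≤ a * B.indicator 1 x :=
      weighted_abs_localPart_le hβ b Q hφ hc
        (hs.trans (ball_subset_ball (by linarith))) x
    have hjump : ENNReal.ofReal ((1 + ‖x‖ ^ β) * |∫ y, jumpIntegrand φ x y ∂ν|) ≤
        ∫⁻ y, ENNReal.ofReal (c * levyWeight β y) * (χ x + χ (x + y)) ∂ν := by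
      rw [← abs_of_nonneg hw, ← abs_mul, ← integral_const_mul, ← Real.enorm_eq_ofReal_abs]
      refine (enorm_integral_le_lintegral_enorm _).trans (lintegral_mono fun y => ?_)
      rw [Real.enorm_eq_ofReal_abs, abs_mul, abs_of_nonneg hw, ← hχ, ← hχ,
        ← ENNReal.ofReal_add (hind _) (hind _),
        ← ENNReal.ofReal_mul (mul_nonneg hc0 (levyWeight_nonneg β y))]
      exact ENNReal.ofReal_le_ofReal (weighted_abs_jumpIntegrand_le hβ hR hφ hc hs x y)
    calc ENNReal.ofReal ((1 + ‖x‖ ^ β) * |levyGen b Q ν φ x|)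
        ≤ ENNReal.ofReal ((1 + ‖x‖ ^ β) * |localPart b Q φ x|
            + (1 + ‖x‖ ^ β) * |∫ y, jumpIntegrand φ x y ∂ν|) := by
          rw [hgen, ← mul_add]
          exact ENNReal.ofReal_le_ofReal (mul_le_mul_of_nonneg_left (abs_add_le _ _) hw)
      _ ≤ _ := by
          rw [ENNReal.ofReal_add (by positivity) (by positivity)]
          refine add_le_add ?_ hjump
          rw [← hχ, ← ENNReal.ofReal_mul ha0]
          exact ENNReal.ofReal_le_ofReal hlocal
  have hlw : Measurable fun y : Ed d => ENNReal.ofReal (c * levyWeight β y) :=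
    ((measurable_levyWeight β).const_mul c).ennreal_ofReal
  have hswap : ∫⁻ x, ∫⁻ y, ENNReal.ofReal (c * levyWeight β y) * (χ x + χ (x + y)) ∂ν =
      ENNReal.ofReal (c * (I₁ + I₂)) * ENNReal.ofReal (V + V) := by
    rw [lintegral_lintegral_swap]
    · have hinner : ∀ y : Ed d,
          ∫⁻ x, ENNReal.ofReal (c * levyWeight β y) * (χ x + χ (x + y)) =
            ENNReal.ofReal (c * levyWeight β y) * ENNReal.ofReal (V + V) := fun y => by
        rw [lintegral_const_mul _ (by fun_prop), lintegral_add_left hχm,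
          lintegral_add_right_eq_self χ y, hχint, ENNReal.ofReal_add hV0 hV0]
      simp_rw [hinner]
      rw [lintegral_mul_const _ hlw]
      simp_rw [ENNReal.ofReal_mul hc0]
      rw [lintegral_const_mul _ (measurable_levyWeight β).ennreal_ofReal, hweight]
    · refine Measurable.aemeasurable ?_
      exact (hlw.comp measurable_snd).mul
        ((hχm.comp measurable_fst).add (hχm.comp (measurable_fst.add measurable_snd)))
  calc ∫⁻ x, ENNReal.ofReal ((1 + ‖x‖ ^ β) * |levyGen b Q ν φ x|)
      ≤ ∫⁻ x, (ENNReal.ofReal a * χ x +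
        ∫⁻ y, ENNReal.ofReal (c * levyWeight β y) * (χ x + χ (x + y)) ∂ν) := lintegral_mono hpt
    _ = ENNReal.ofReal (a * V + c * (I₁ + I₂) * (V + V)) := by
      rw [lintegral_add_left (hχm.const_mul _), lintegral_const_mul _ hχm, hswap, hχint,
        ← ENNReal.ofReal_mul ha0, ← ENNReal.ofReal_mul (by positivity),
        ← ENNReal.ofReal_add (by positivity) (by positivity)]
    _ ≤ _ := by
      refine ENNReal.ofReal_le_ofReal ?_
      have hP : 0 ≤ W * cbNorm2 φ := by positivity
      have hkey : V * (‖b‖ + (d : ℝ) ^ 2 * q) + 4 * V * (I₁ + I₂) ≤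
          (V + 1) * ((d : ℝ) ^ 2 + 4) * (‖b‖ + q + I₁ + I₂) := by
        have hdiff : 0 ≤ V * ((d : ℝ) ^ 2 + 3) * ‖b‖ + V * 4 * q + V * (d : ℝ) ^ 2 * (I₁ + I₂)
            + ((d : ℝ) ^ 2 + 4) * (‖b‖ + q + I₁ + I₂) := by positivity
        linarith
      calc a * V + c * (I₁ + I₂) * (V + V)
          = W * cbNorm2 φ * (V * (‖b‖ + (d : ℝ) ^ 2 * q) + 4 * V * (I₁ + I₂)) := by
            rw [ha, hcdef]; ring
        _ ≤ W * cbNorm2 φ * ((V + 1) * ((d : ℝ) ^ 2 + 4) * (‖b‖ + q + I₁ + I₂)) :=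
            mul_le_mul_of_nonneg_left hkey hP
        _ = _ := by ring

/-- **Weighted integrability of `Aφ` for test functions.** If `∫_{|y|≥1} |y|^β ν(dy) < ∞`, then
`∫ (1+|x|^β)|Aφ(x)| dx < ∞` for every `φ ∈ C_c^∞`; moreover, for every `R > 0` there is a
constant `C > 0` depending only on `d`, `β` and `R` such that the stated estimate holds for all
test functions supported in `B(0,R)`. -/
theorem statement2 {d : ℕ} (β : ℝ) (hβ : 0 < β) :
    (∀ (b : Ed d) (Q : Matrix (Fin d) (Fin d) ℝ) (ν : Measure (Ed d)), IsLevyTriplet b Q ν →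
      IntegrableOn (fun y => ‖y‖ ^ β) {y : Ed d | 1 ≤ ‖y‖} ν →
      ∀ φ : Ed d → ℝ, ContDiff ℝ (⊤ : ℕ∞) φ → HasCompactSupport φ →
        Integrable (fun x => (1 + ‖x‖ ^ β) * |levyGen b Q ν φ x|)) ∧
    (∀ R : ℝ, 0 < R → ∃ C : ℝ, 0 < C ∧
      ∀ (b : Ed d) (Q : Matrix (Fin d) (Fin d) ℝ) (ν : Measure (Ed d)), IsLevyTriplet b Q ν →
        IntegrableOn (fun y => ‖y‖ ^ β) {y : Ed d | 1 ≤ ‖y‖} ν →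
        ∀ φ : Ed d → ℝ, ContDiff ℝ (⊤ : ℕ∞) φ → HasCompactSupport φ →
          tsupport φ ⊆ ball (0 : Ed d) R →
          ∫ x, (1 + ‖x‖ ^ β) * |levyGen b Q ν φ x|
            ≤ C * cbNorm2 φ * (‖b‖ + Real.sqrt (∑ i, ∑ j, (Q i j) ^ 2)
                + (∫ y in {y : Ed d | ‖y‖ ≤ 1}, ‖y‖ ^ 2 ∂ν)
                + ∫ y in {y : Ed d | 1 < ‖y‖}, ‖y‖ ^ β ∂ν)) := by
  have hmeas : ∀ (b : Ed d) (Q : Matrix (Fin d) (Fin d) ℝ) (ν : Measure (Ed d)),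
      IsLevyTriplet b Q ν → ∀ φ : Ed d → ℝ, ContDiff ℝ (⊤ : ℕ∞) φ →
        AEStronglyMeasurable (fun x => (1 + ‖x‖ ^ β) * |levyGen b Q ν φ x|) volume := by
    intro b Q ν h φ hφ
    have hg := measurable_levyGen h hφ
    exact Measurable.aestronglyMeasurable
      ((by fun_prop : Measurable fun x : Ed d => 1 + ‖x‖ ^ β).mul hg.abs)
  have hnonneg : ∀ (b : Ed d) (Q : Matrix (Fin d) (Fin d) ℝ) (ν : Measure (Ed d)) (φ : Ed d → ℝ),
      ∀ᵐ x : Ed d, 0 ≤ (1 + ‖x‖ ^ β) * |levyGen b Q ν φ x| := fun _ _ _ _ =>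
    ae_of_all _ fun _ => by positivity
  refine ⟨fun b Q ν h hν φ hφ hc => ?_, fun R hR =>
    ⟨(1 + (R + 1) ^ β) * (volume.real (ball (0 : Ed d) (R + 1)) + 1) * ((d : ℝ) ^ 2 + 4),
      by positivity, fun b Q ν h hν φ hφ hc hs => ?_⟩⟩
  · obtain ⟨R, hR, hs⟩ := hc.isCompact.isBounded.subset_ball_lt 0 (0 : Ed d)
    refine ⟨hmeas b Q ν h φ hφ, ?_⟩
    rw [hasFiniteIntegral_iff_ofReal (hnonneg b Q ν φ)]
    exact (lintegral_weighted_levyGen_le hβ hR h hν hφ hc hs).trans_lt ENNReal.ofReal_lt_top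
  · have hM : 0 ≤ cbNorm2 φ := (abs_nonneg _).trans (abs_le_cbNorm2 hφ hc 0)
    have hI1 : 0 ≤ ∫ y in {y : Ed d | ‖y‖ ≤ 1}, ‖y‖ ^ 2 ∂ν :=
      integral_nonneg fun _ => by positivity
    have hI2 : 0 ≤ ∫ y in {y : Ed d | 1 < ‖y‖}, ‖y‖ ^ β ∂ν :=
      integral_nonneg fun _ => by positivity
    rw [integral_eq_lintegral_of_nonneg_ae (hnonneg b Q ν φ) (hmeas b Q ν h φ hφ)]
    exact ENNReal.toReal_le_of_le_ofReal (by positivity)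
      (lintegral_weighted_levyGen_le hβ hR h hν hφ hc hs)
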